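/- arXiv:2411.05808 — 2 statements merged into one kernel-verified Lean document; each statement's English description precedes it below -/
import Mathlib

section
/- For every ℓ with 1 ≤ ℓ ≤ k, as R → ∞, (R^d f(R)^{2k−ℓ})^{−1} ∫_{(ℝ^d)^{2k−ℓ}} φ_1((y_1,…,y_k)/R) h_k(y_1,…,y_k) φ_2((y_1,…,y_ℓ,y_{k+1},…,y_{2k−ℓ})/R) h_k(y_1,…,y_ℓ,y_{k+1},…,y_{2k−ℓ}) Π_{i=1}^{2k−ℓ} f(y_i) dy converges to D_{k,ℓ} · ∫_{ℝ^d} φ_1(x,…,x) φ_2(x,…,x) |x|^{−α(2k−ℓ)} dx. -/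
open MeasureTheory Filter Topology

noncomputable section

/-- Euclidean space `ℝ^d`. -/
abbrev Euc (d : ℕ) : Type := EuclideanSpace ℝ (Fin d)

/-- Safe access to the `i`-th entry of a finite tuple of points (junk value `0` out of range). -/
def vget {d n : ℕ} (z : Fin n → Euc d) (i : ℕ) : Euc d :=
  if h : i < n then z ⟨i, h⟩ else 0

/-- The `k`-tuple `(0, z₁, …, z_{k-1})`. -/
def padFirst {d : ℕ} (k : ℕ) {n : ℕ} (z : Fin n → Euc d) : Fin k → Euc d :=
  fun j => if (j : ℕ) = 0 then 0 else vget z ((j : ℕ) - 1)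

/-- The `k`-tuple `(0, z₁, …, z_{ℓ-1}, z_k, …, z_{2k-ℓ-1})`. -/
def padSecond {d : ℕ} (k ℓ : ℕ) {n : ℕ} (z : Fin n → Euc d) : Fin k → Euc d :=
  fun j => if (j : ℕ) = 0 then 0
    else if (j : ℕ) < ℓ then vget z ((j : ℕ) - 1)
    else vget z ((j : ℕ) + k - ℓ - 1)

/-- The sub-tuple `(y₁, …, y_k)` of a `(2k-ℓ)`-tuple `y`. -/
def sel1 {d : ℕ} (k : ℕ) {n : ℕ} (y : Fin n → Euc d) : Fin k → Euc d :=
  fun i => vget y (i : ℕ)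

/-- The sub-tuple `(y₁, …, y_ℓ, y_{k+1}, …, y_{2k-ℓ})` of a `(2k-ℓ)`-tuple `y`. -/
def sel2 {d : ℕ} (k ℓ : ℕ) {n : ℕ} (y : Fin n → Euc d) : Fin k → Euc d :=
  fun i => if (i : ℕ) < ℓ then vget y (i : ℕ) else vget y ((i : ℕ) + (k - ℓ))

/-- The surface area `s_{d-1}` of the unit sphere in `ℝ^d`. -/
def sArea (d : ℕ) : ℝ := d * (volume (Metric.ball (0 : Euc d) 1)).toReal

/-- Uniform convergence theorem for measurable functions whose increments vanish at infinity. -/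
theorem eventually_forall_abs_le_abs_sub_le {g : ℝ → ℝ} (hg : Measurable g)
    (hlim : ∀ v : ℝ, Tendsto (fun u => g (u + v) - g u) atTop (𝓝 0))
    {A ε : ℝ} (hA : 0 ≤ A) (hε : 0 < ε) :
    ∀ᶠ u in atTop, ∀ v, |v| ≤ A → |g (u + v) - g u| ≤ ε := by
  set B : ℝ := A + 1 with hB
  set bad : ℝ → Set ℝ := fun u => {w | ε / 2 ≤ |g (u + w) - g u|} with hbad
  have hbadm : ∀ u, MeasurableSet (bad u) := fun u =>
    measurableSet_le measurable_const (by fun_prop)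
  have hbad0 : Tendsto (fun u => volume.restrict (Set.Icc (-B) B) (bad u)) atTop (𝓝 0) := by
    have := tendsto_measure_of_ae_tendsto_indicator_of_isFiniteMeasure (L := atTop)
      (μ := volume.restrict (Set.Icc (-B) B)) (A := ∅) (As := bad) MeasurableSet.empty hbadm
      (Eventually.of_forall fun w => by
        have h1 := (tendsto_order.1 (hlim w).abs).2 (ε / 2) (by simpa using hε)
        filter_upwards [h1] with u hu
        simpa [hbad] using hu)
    simpa using this
  have hsmall : ∀ᶠ u in atTop, volume.restrict (Set.Icc (-B) B) (bad u) < 1 :=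
    (tendsto_order.1 hbad0).2 1 one_pos
  obtain ⟨U, hU⟩ := eventually_atTop.1 hsmall
  filter_upwards [eventually_ge_atTop (U + A)] with u hu v hv
  obtain ⟨hv1, hv2⟩ := abs_le.1 hv
  have b1 := hU u (by linarith)
  have b2 := hU (u + v) (by linarith)
  rw [Measure.restrict_apply (hbadm _)] at b1 b2
  have b3 : volume ((fun w => w - v) ⁻¹' (bad (u + v) ∩ Set.Icc (-B) B)) < 1 := by
    simpa only [sub_eq_add_neg, measure_preimage_add_right] using b2
  set I : Set ℝ := Set.Icc (max (-B) (v - B)) (min B (v + B)) with hI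
  have hIvol : (2 : ENNReal) ≤ volume I := by
    rw [hI, Real.volume_Icc, ← ENNReal.ofReal_ofNat]
    apply ENNReal.ofReal_le_ofReal
    rcases max_cases (-B) (v - B) with h1 | h1 <;> rcases min_cases B (v + B) with h2 | h2 <;>
      linarith
  have hnot : ¬ I ⊆ (bad u ∩ Set.Icc (-B) B) ∪
      ((fun w => w - v) ⁻¹' (bad (u + v) ∩ Set.Icc (-B) B)) := by
    intro hsub
    have h1 := (measure_mono hsub).trans (measure_union_le (μ := volume) _ _)
    have h2 := ENNReal.add_lt_add b1 b3
    have h3 := (hIvol.trans h1).trans_lt h2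
    rw [one_add_one_eq_two] at h3
    exact lt_irrefl _ h3
  obtain ⟨w, hw, hwn⟩ := Set.not_subset.1 hnot
  simp only [hI, Set.mem_Icc, max_le_iff, le_min_iff] at hw
  obtain ⟨⟨w1, w2⟩, w3, w4⟩ := hw
  simp only [hbad, Set.mem_union, Set.mem_inter_iff, Set.mem_preimage, Set.mem_ofPred_eq,
    Set.mem_Icc, not_or, not_and] at hwn
  have c1 : |g (u + w) - g u| < ε / 2 := by
    by_contra! hc
    exact hwn.1 hc w1 w3
  have c2 : |g (u + v + (w - v)) - g (u + v)| < ε / 2 := by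
    by_contra! hc
    exact hwn.2 hc (by linarith) (by linarith)
  rw [show u + v + (w - v) = u + w by ring] at c2
  rw [abs_lt] at c1 c2
  rw [abs_le]
  constructor <;> linarith [c1.1, c1.2, c2.1, c2.2]

/-- Linear growth bound for increments over half-lines. -/
theorem eventually_forall_abs_sub_le_mul {g : ℝ → ℝ} (hg : Measurable g)
    (hlim : ∀ v : ℝ, Tendsto (fun u => g (u + v) - g u) atTop (𝓝 0))
    {ε : ℝ} (hε : 0 < ε) :
    ∀ᶠ u in atTop, ∀ v, 0 ≤ v → |g (u + v) - g u| ≤ ε * (v + 1) := by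
  obtain ⟨U, hU⟩ := eventually_atTop.1
    (eventually_forall_abs_le_abs_sub_le hg hlim zero_le_one hε)
  have key : ∀ n : ℕ, ∀ u, U ≤ u → ∀ v : ℝ, 0 ≤ v → v ≤ n + 1 → |g (u + v) - g u| ≤ ε * (v + 1) := by
    intro n
    induction n with
    | zero =>
      intro u hu v hv hv'
      refine (hU u hu v (by rw [abs_of_nonneg hv]; simpa using hv')).trans ?_
      nlinarith
    | succ n ih =>
      intro u hu v hv hv'
      rcases le_total v 1 with h1 | h1
      · refine (hU u hu v (by rwa [abs_of_nonneg hv])).trans ?_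
        nlinarith
      · have e1 := ih (u + 1) (by linarith) (v - 1) (by linarith) (by push_cast at hv'; linarith)
        have e2 := hU u hu 1 (by simp)
        rw [show u + 1 + (v - 1) = u + v by ring] at e1
        rw [abs_le] at *
        constructor <;> linarith [e1.1, e1.2, e2.1, e2.2]
  filter_upwards [eventually_ge_atTop U] with u hu v hv
  obtain ⟨n, hn⟩ := exists_nat_ge v
  exact key n u hu v hv (by linarith)

/-- The logarithmic slowly varying part of `f`. -/
def logSlow (α : ℝ) (f : ℝ → ℝ) (u : ℝ) : ℝ := Real.log (f (Real.exp u)) + α * u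

theorem measurable_logSlow (α : ℝ) {f : ℝ → ℝ} (hf : Measurable f) :
    Measurable (logSlow α f) := by
  unfold logSlow
  fun_prop

theorem tendsto_logSlow_sub {α : ℝ} {f : ℝ → ℝ} (hfpos : ∀ᶠ r in atTop, 0 < f r)
    (hfreg : ∀ r : ℝ, 0 < r → Tendsto (fun t => f (t * r) / f t) atTop (𝓝 (r ^ (-α))))
    (v : ℝ) : Tendsto (fun u => logSlow α f (u + v) - logSlow α f u) atTop (𝓝 0) := by
  have h1 := (hfreg _ (Real.exp_pos v)).comp Real.tendsto_exp_atTop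
  have h2 := (h1.log (Real.rpow_pos_of_pos (Real.exp_pos v) _).ne').add_const (α * v)
  rw [Real.log_rpow (Real.exp_pos v), Real.log_exp, neg_mul, neg_add_cancel] at h2
  refine h2.congr' ?_
  have h3 := Real.tendsto_exp_atTop.eventually hfpos
  have h4 := (tendsto_atTop_add_const_right atTop v tendsto_id).eventually h3
  filter_upwards [h3, h4] with u h3 h4
  simp only [id] at h4
  simp only [Function.comp, logSlow, ← Real.exp_add]
  rw [Real.log_div h4.ne' h3.ne']
  ring

theorem div_eq_rpow_mul_exp_logSlow {α : ℝ} {f : ℝ → ℝ} {R s : ℝ} (hR : 0 < R) (hs : 0 < s)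
    (h1 : 0 < f R) (h2 : 0 < f (R * s)) :
    f (R * s) / f R = s ^ (-α) *
      Real.exp (logSlow α f (Real.log R + Real.log s) - logSlow α f (Real.log R)) := by
  rw [logSlow, logSlow, Real.exp_add, Real.exp_log hR, Real.exp_log hs, Real.rpow_def_of_pos hs,
    ← Real.exp_add,
    show Real.log s * -α + (Real.log (f (R * s)) + α * (Real.log R + Real.log s) -
      (Real.log (f R) + α * Real.log R)) = Real.log (f (R * s)) - Real.log (f R) by ring,
    Real.exp_sub, Real.exp_log h1, Real.exp_log h2]

/-- Regular variation along converging ratios. -/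
theorem tendsto_div_of_tendsto {α : ℝ} {f : ℝ → ℝ} (hfm : Measurable f)
    (hfpos : ∀ᶠ r in atTop, 0 < f r)
    (hfreg : ∀ r : ℝ, 0 < r → Tendsto (fun t => f (t * r) / f t) atTop (𝓝 (r ^ (-α))))
    {s : ℝ → ℝ} {s₀ : ℝ} (hs₀ : 0 < s₀) (hs : Tendsto s atTop (𝓝 s₀)) :
    Tendsto (fun R => f (R * s R) / f R) atTop (𝓝 (s₀ ^ (-α))) := by
  have hlog : Tendsto (fun R => Real.log (s R)) atTop (𝓝 (Real.log s₀)) := hs.log hs₀.ne'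
  have hexp : Tendsto (fun R => logSlow α f (Real.log R + Real.log (s R)) -
      logSlow α f (Real.log R)) atTop (𝓝 0) := by
    rw [Metric.tendsto_nhds]
    intro ε hε
    have h1 := Real.tendsto_log_atTop.eventually
      (eventually_forall_abs_le_abs_sub_le (measurable_logSlow α hfm)
        (tendsto_logSlow_sub hfpos hfreg) (A := |Real.log s₀| + 1) (by positivity) (half_pos hε))
    have h2 := (tendsto_order.1 hlog.abs).2 (|Real.log s₀| + 1) (by linarith)
    filter_upwards [h1, h2] with R h1 h2
    rw [Real.dist_eq, sub_zero]
    exact (h1 _ h2.le).trans_lt (half_lt_self hε)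
  have hmain := (hs.rpow_const (p := -α) (Or.inl hs₀.ne')).mul hexp.rexp
  rw [Real.exp_zero, mul_one] at hmain
  refine hmain.congr' ?_
  have hsp : ∀ᶠ R in atTop, 0 < s R := (tendsto_order.1 hs).1 0 hs₀
  have hRs := (tendsto_id.atTop_mul_pos hs₀ hs).eventually hfpos
  filter_upwards [hsp, hRs, hfpos, eventually_gt_atTop 0] with R h1 h2 h3 h4
  exact (div_eq_rpow_mul_exp_logSlow h4 h1 h3 h2).symm

/-- Potter-type upper bound for a regularly varying function, away from the origin. -/
theorem exists_div_le_mul_one_add_rpow {α β a : ℝ} {f : ℝ → ℝ} (hfm : Measurable f)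
    (hfpos : ∀ᶠ r in atTop, 0 < f r)
    (hfreg : ∀ r : ℝ, 0 < r → Tendsto (fun t => f (t * r) / f t) atTop (𝓝 (r ^ (-α))))
    (hβ : 0 < β) (hβα : β < α) (ha : 0 < a) :
    ∃ C, 0 < C ∧ ∀ᶠ R in atTop, ∀ s, a ≤ s → f (R * s) / f R ≤ C * (1 + s) ^ (-β) := by
  set ε := α - β with hε
  have hε0 : 0 < ε := sub_pos.2 hβα
  set C₁ := Real.exp ε * 2 ^ β
  set C₂ := a ^ (-α) * Real.exp ε * 2 ^ β
  refine ⟨C₁ + C₂, by positivity, ?_⟩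
  have hm := measurable_logSlow α hfm
  have hl := tendsto_logSlow_sub hfpos hfreg
  have h1 := Real.tendsto_log_atTop.eventually
    (eventually_forall_abs_le_abs_sub_le hm hl (A := |Real.log a|) (by positivity) hε0)
  have h2 := Real.tendsto_log_atTop.eventually (eventually_forall_abs_sub_le_mul hm hl hε0)
  obtain ⟨T, hT⟩ := eventually_atTop.1 hfpos
  filter_upwards [h1, h2, eventually_gt_atTop 0, eventually_ge_atTop T,
    eventually_ge_atTop (T / a)] with R h1 h2 hR hRT hRTa s has
  have hs : 0 < s := ha.trans_le has
  have hRs : T ≤ R * s := by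
    rw [div_le_iff₀ ha] at hRTa
    exact hRTa.trans (by gcongr)
  rw [div_eq_rpow_mul_exp_logSlow (α := α) hR hs (hT _ hRT) (hT _ hRs)]
  have hpos : 0 < (1 + s) ^ (-β) := by positivity
  rcases le_total 1 s with hs1 | hs1
  · have h3 := (abs_le.1 (h2 (Real.log s) (Real.log_nonneg hs1))).2
    calc _ ≤ s ^ (-α) * Real.exp (ε * (Real.log s + 1)) := by gcongr
      _ = Real.exp ε * s ^ (-β) := by
        rw [Real.rpow_def_of_pos hs, Real.rpow_def_of_pos hs, ← Real.exp_add, ← Real.exp_add, hε]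
        ring_nf
      _ ≤ Real.exp ε * (2 ^ β * (1 + s) ^ (-β)) := by
        gcongr
        rw [← div_le_iff₀' (by positivity), Real.rpow_neg hs.le, Real.rpow_neg (by positivity),
          div_eq_mul_inv, ← mul_inv, ← Real.mul_rpow hs.le (by positivity)]
        gcongr
        linarith
      _ = C₁ * (1 + s) ^ (-β) := by ring
      _ ≤ _ := by gcongr; linarith [show 0 < C₂ by positivity]
  · have hlog : |Real.log s| ≤ |Real.log a| := by
      have := Real.log_le_log ha has
      have h0 := Real.log_nonpos hs.le hs1
      rw [abs_of_nonpos h0, abs_of_nonpos (this.trans h0)]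
      linarith
    have h3 := (abs_le.1 (h1 _ hlog)).2
    have h4 : (1 : ℝ) ≤ 2 ^ β * (1 + s) ^ (-β) := by
      rw [Real.rpow_neg (by positivity), ← div_eq_mul_inv, one_le_div (by positivity)]
      gcongr
      linarith
    calc _ ≤ a ^ (-α) * Real.exp ε := by
          gcongr ?_ * Real.exp ?_
          exact Real.rpow_le_rpow_of_nonpos ha has (by linarith)
      _ ≤ a ^ (-α) * Real.exp ε * (2 ^ β * (1 + s) ^ (-β)) :=
        le_mul_of_one_le_right (by positivity) h4
      _ = C₂ * (1 + s) ^ (-β) := by ring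
      _ ≤ _ := by gcongr; linarith [show 0 < C₁ by positivity]

section Shift

variable {d n : ℕ}

/-- The configuration with first point `x` and remaining points `x + z i`. -/
def shiftTuple (x : Euc d) (z : Fin n → Euc d) : Fin (n + 1) → Euc d :=
  fun j => x + (Fin.cons 0 z : Fin (n + 1) → Euc d) j

theorem cons_zero_apply_mk (z : Fin n → Euc d) {i : ℕ} (hi : i < n + 1) :
    (Fin.cons 0 z : Fin (n + 1) → Euc d) ⟨i, hi⟩ = if i = 0 then 0 else vget z (i - 1) := by
  cases i with
  | zero => rfl
  | succ i =>
    have hi' : i < n := by omega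
    rw [show (⟨i + 1, hi⟩ : Fin (n + 1)) = Fin.succ ⟨i, hi'⟩ from rfl, Fin.cons_succ]
    simp [vget, hi']

theorem sel1_shiftTuple {k : ℕ} (hk : k ≤ n + 1) (x : Euc d) (z : Fin n → Euc d) (i : Fin k) :
    sel1 k (shiftTuple x z) i = x + padFirst k z i := by
  have hi : (i : ℕ) < n + 1 := by omega
  rw [sel1, vget, dif_pos hi, shiftTuple, cons_zero_apply_mk, padFirst]

theorem sel2_shiftTuple {k ℓ : ℕ} (hℓ : 1 ≤ ℓ) (hℓk : ℓ ≤ k) (hn : 2 * k - ℓ = n + 1)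
    (x : Euc d) (z : Fin n → Euc d) (i : Fin k) :
    sel2 k ℓ (shiftTuple x z) i = x + padSecond k ℓ z i := by
  have hi := i.isLt
  rw [sel2, padSecond]
  split_ifs with h1 h2 h2
  · rw [vget, dif_pos (by omega), shiftTuple, cons_zero_apply_mk, if_pos h2]
  · rw [vget, dif_pos (by omega), shiftTuple, cons_zero_apply_mk, if_neg h2]
  · omega
  · rw [vget, dif_pos (by omega), shiftTuple, cons_zero_apply_mk, if_neg (by omega)]
    congr 2
    omega

theorem exists_padFirst_or_padSecond_eq {k ℓ : ℕ} (hℓ : 1 ≤ ℓ) (hℓk : ℓ ≤ k)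
    (hn : 2 * k - ℓ = n + 1) (z : Fin n → Euc d) (j : Fin (n + 1)) :
    (∃ i : Fin k, padFirst k z i = (Fin.cons 0 z : Fin (n + 1) → Euc d) j) ∨
      ∃ i : Fin k, padSecond k ℓ z i = (Fin.cons 0 z : Fin (n + 1) → Euc d) j := by
  obtain ⟨j, hj⟩ := j
  rw [cons_zero_apply_mk]
  rcases lt_or_ge j k with h | h
  · exact Or.inl ⟨⟨j, h⟩, rfl⟩
  · refine Or.inr ⟨⟨j - (k - ℓ), by omega⟩, ?_⟩
    rw [padSecond, if_neg (by simp only; omega), if_neg (by simp only; omega), if_neg (by omega)]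
    congr 1
    simp only
    omega

theorem measurable_vget (i : ℕ) : Measurable fun z : Fin n → Euc d => vget z i := by
  unfold vget
  split_ifs
  · exact measurable_pi_apply _
  · exact measurable_const

theorem measurable_padFirst (k : ℕ) : Measurable (padFirst (d := d) (n := n) k) := by
  refine measurable_pi_iff.2 fun j => ?_
  unfold padFirst
  split_ifs
  · exact measurable_const
  · exact measurable_vget _

theorem measurable_padSecond (k ℓ : ℕ) : Measurable (padSecond (d := d) (n := n) k ℓ) := by
  refine measurable_pi_iff.2 fun j => ?_
  unfold padSecond
  split_ifs
  · exact measurable_const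
  · exact measurable_vget _
  · exact measurable_vget _

theorem measurable_sel1 (k : ℕ) : Measurable (sel1 (d := d) (n := n) k) :=
  measurable_pi_iff.2 fun _ => measurable_vget _

theorem measurable_sel2 (k ℓ : ℕ) : Measurable (sel2 (d := d) (n := n) k ℓ) := by
  refine measurable_pi_iff.2 fun j => ?_
  unfold sel2
  split_ifs
  · exact measurable_vget _
  · exact measurable_vget _

theorem measurePreserving_shiftTuple :
    MeasurePreserving (fun p : Euc d × (Fin n → Euc d) => shiftTuple p.1 p.2)
      (volume.prod volume) volume := by
  have h1 : MeasurePreserving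
      (fun p : Euc d × (Fin n → Euc d) => (p.1, (fun _ => p.1) + p.2))
      (volume.prod volume) (volume.prod volume) :=
    (MeasurePreserving.id volume).skew_product
      (g := fun (x : Euc d) (z : Fin n → Euc d) => (fun _ => x) + z)
      (measurable_pi_iff.2 fun i => by
        simp only [Function.uncurry, Pi.add_apply]
        fun_prop)
      (Eventually.of_forall fun x =>
        (measurePreserving_add_left (volume : Measure (Fin n → Euc d)) (fun _ => x)).map_eq)
  have h2 := (volume_preserving_piFinSuccAbove (fun _ : Fin (n + 1) => Euc d) 0).symm.comp h1
  refine Eq.subst (motive := fun g => MeasurePreserving g _ _) ?_ h2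
  funext p j
  refine Fin.cases ?_ (fun i => ?_) j
  · simp [shiftTuple, MeasurableEquiv.piFinSuccAbove]
  · simp [shiftTuple, MeasurableEquiv.piFinSuccAbove]

/-- Scaling the first point and recentring the others at it. -/
theorem inv_pow_mul_integral_eq {F : (Fin (n + 1) → Euc d) → ℝ} (hF : Measurable F)
    {R : ℝ} (hR : 0 < R) :
    (R ^ d)⁻¹ * ∫ y, F y =
      ∫ p : Euc d × (Fin n → Euc d), F (shiftTuple (R • p.1) p.2) ∂(volume.prod volume) := by
  have hm := measurePreserving_shiftTuple (d := d) (n := n)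
  have hs : Measurable fun x : Euc d => R • x := measurable_const_smul R
  have h1 : (volume.prod volume : Measure (Euc d × (Fin n → Euc d))).map (Prod.map (R • ·) id) =
      ENNReal.ofReal ((R ^ d)⁻¹) • (volume.prod volume) := by
    rw [← Measure.map_prod_map _ _ hs measurable_id, Measure.map_id,
      Measure.map_addHaar_smul _ hR.ne', Measure.prod_smul_left, finrank_euclideanSpace_fin,
      abs_of_pos (by positivity)]
  have h2 : ∫ p : Euc d × (Fin n → Euc d), F (shiftTuple (R • p.1) p.2) ∂(volume.prod volume) =
      ∫ p, F (shiftTuple p.1 p.2) ∂((volume.prod volume).map (Prod.map (R • ·) id)) := by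
    exact (integral_map (hs.prodMap measurable_id).aemeasurable
      (hF.comp hm.measurable).aestronglyMeasurable).symm
  rw [h2, h1, integral_smul_measure, ENNReal.toReal_ofReal (by positivity), smul_eq_mul,
    ← hm.map_eq, integral_map hm.measurable.aemeasurable hF.aestronglyMeasurable]

/-- The rescaled integrand after the change of variables. -/
def rescaledIntegrand (k ℓ : ℕ) (f : ℝ → ℝ) (h φ₁ φ₂ : (Fin k → Euc d) → ℝ) (R : ℝ)
    (p : Euc d × (Fin n → Euc d)) : ℝ :=
  φ₁ (fun i => p.1 + R⁻¹ • padFirst k p.2 i) * h (padFirst k p.2) *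
    (φ₂ (fun i => p.1 + R⁻¹ • padSecond k ℓ p.2 i) * h (padSecond k ℓ p.2)) *
    ∏ j : Fin (n + 1), f (R * ‖p.1 + R⁻¹ • (Fin.cons 0 p.2 : Fin (n + 1) → Euc d) j‖) / f R

theorem measurable_cons_zero_apply (j : Fin (n + 1)) :
    Measurable fun z : Fin n → Euc d => (Fin.cons 0 z : Fin (n + 1) → Euc d) j := by
  refine Fin.cases ?_ (fun i => ?_) j
  · exact measurable_const
  · exact measurable_pi_apply i

theorem measurable_rescaledIntegrand (k ℓ : ℕ) {f : ℝ → ℝ} {h φ₁ φ₂ : (Fin k → Euc d) → ℝ}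
    (hf : Measurable f) (hh : Measurable h) (h₁ : Measurable φ₁) (h₂ : Measurable φ₂) (R : ℝ) :
    Measurable (rescaledIntegrand (n := n) k ℓ f h φ₁ φ₂ R) := by
  have mp : Measurable fun p : Euc d × (Fin n → Euc d) => padFirst k p.2 :=
    (measurable_padFirst k).comp measurable_snd
  have mq : Measurable fun p : Euc d × (Fin n → Euc d) => padSecond k ℓ p.2 :=
    (measurable_padSecond k ℓ).comp measurable_snd
  have mc : ∀ j, Measurable fun p : Euc d × (Fin n → Euc d) =>
      (Fin.cons 0 p.2 : Fin (n + 1) → Euc d) j := fun j =>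
    (measurable_cons_zero_apply j).comp measurable_snd
  have madd : ∀ g : Euc d × (Fin n → Euc d) → Euc d, Measurable g →
      Measurable fun p => p.1 + R⁻¹ • g p := fun g hg => by fun_prop
  have mφ₁ := h₁.comp (measurable_pi_iff.2 fun i => madd _ (measurable_pi_iff.1 mp i))
  have mφ₂ := h₂.comp (measurable_pi_iff.2 fun i => madd _ (measurable_pi_iff.1 mq i))
  have mf := fun j => (hf.comp ((madd _ (mc j)).norm.const_mul R)).div_const (f R)
  exact ((mφ₁.mul (hh.comp mp)).mul (mφ₂.mul (hh.comp mq))).mul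
    (Finset.measurable_prod _ fun j _ => mf j)

theorem inv_mul_integral_eq_integral_rescaledIntegrand {k ℓ : ℕ} (hℓ : 1 ≤ ℓ) (hℓk : ℓ ≤ k)
    (hn : 2 * k - ℓ = n + 1) {f : ℝ → ℝ} {h φ₁ φ₂ : (Fin k → Euc d) → ℝ}
    (hf : Measurable f) (hh : Measurable h) (h₁ : Measurable φ₁) (h₂ : Measurable φ₂)
    (hhtrans : ∀ (x : Euc d) (y : Fin k → Euc d), h (fun i => x + y i) = h y)
    {R : ℝ} (hR : 0 < R) :
    (R ^ d * f R ^ (n + 1))⁻¹ *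
      ∫ y : Fin (n + 1) → Euc d,
        φ₁ (fun i : Fin k => R⁻¹ • sel1 k y i) * h (sel1 k y) *
          (φ₂ (fun i : Fin k => R⁻¹ • sel2 k ℓ y i) * h (sel2 k ℓ y)) * ∏ i, f ‖y i‖ =
    ∫ p : Euc d × (Fin n → Euc d), rescaledIntegrand k ℓ f h φ₁ φ₂ R p
      ∂(volume.prod volume) := by
  have m1 := measurable_sel1 (d := d) (n := n + 1) k
  have m2 := measurable_sel2 (d := d) (n := n + 1) k ℓ
  rw [mul_inv, mul_comm (R ^ d)⁻¹, mul_assoc, inv_pow_mul_integral_eq ?_ hR,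
    ← integral_const_mul]
  · congr 1
    funext p
    have e1 : sel1 k (shiftTuple (R • p.1) p.2) = fun i => R • p.1 + padFirst k p.2 i :=
      funext fun i => sel1_shiftTuple (by omega) _ _ i
    have e2 : sel2 k ℓ (shiftTuple (R • p.1) p.2) = fun i => R • p.1 + padSecond k ℓ p.2 i :=
      funext fun i => sel2_shiftTuple hℓ hℓk hn _ _ i
    have e3 : ∀ j, f ‖shiftTuple (R • p.1) p.2 j‖ =
        f (R * ‖p.1 + R⁻¹ • (Fin.cons 0 p.2 : Fin (n + 1) → Euc d) j‖) := fun j => by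
      rw [shiftTuple, ← abs_of_pos hR, ← Real.norm_eq_abs, ← norm_smul, Real.norm_eq_abs,
        abs_of_pos hR, smul_add, smul_inv_smul₀ hR.ne']
    have e4 : ∀ v : Euc d, R⁻¹ • (R • p.1 + v) = p.1 + R⁻¹ • v := fun v => by
      rw [smul_add, inv_smul_smul₀ hR.ne']
    simp only [e1, e2, e3, e4, hhtrans, rescaledIntegrand, Finset.prod_div_distrib,
      Finset.prod_const, Finset.card_univ, Fintype.card_fin]
    ring
  · refine ((Measurable.mul ?_ ?_).mul (Measurable.mul ?_ ?_)).mul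
      (Finset.measurable_prod _ fun j _ => ?_)
    · exact h₁.comp ((measurable_const_smul R⁻¹).comp m1)
    · exact hh.comp m1
    · exact h₂.comp ((measurable_const_smul R⁻¹).comp m2)
    · exact hh.comp m2
    · exact hf.comp (measurable_pi_apply j).norm

theorem tendsto_add_inv_smul (x v : Euc d) :
    Tendsto (fun R : ℝ => x + R⁻¹ • v) atTop (𝓝 x) := by
  simpa using ((tendsto_inv_atTop_zero (𝕜 := ℝ)).smul_const v).const_add x

theorem tendsto_rescaledIntegrand (k ℓ : ℕ) {α : ℝ} {f : ℝ → ℝ} (hfm : Measurable f)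
    (hfpos : ∀ᶠ r in atTop, 0 < f r)
    (hfreg : ∀ r : ℝ, 0 < r → Tendsto (fun t => f (t * r) / f t) atTop (𝓝 (r ^ (-α))))
    (h : (Fin k → Euc d) → ℝ) {φ₁ φ₂ : (Fin k → Euc d) → ℝ}
    (hφ₁ : Continuous φ₁) (hφ₂ : Continuous φ₂)
    {x : Euc d} (hx : x ≠ 0) (z : Fin n → Euc d) :
    Tendsto (fun R => rescaledIntegrand k ℓ f h φ₁ φ₂ R (x, z)) atTop
      (𝓝 ((φ₁ (fun _ => x) * φ₂ (fun _ => x) * ‖x‖ ^ (-(α * ((n + 1 : ℕ) : ℝ)))) *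
        (h (padFirst k z) * h (padSecond k ℓ z)))) := by
  have t1 := (hφ₁.tendsto fun _ => x).comp
    (tendsto_pi_nhds.2 fun i => tendsto_add_inv_smul x (padFirst k z i))
  have t2 := (hφ₂.tendsto fun _ => x).comp
    (tendsto_pi_nhds.2 fun i => tendsto_add_inv_smul x (padSecond k ℓ z i))
  have t3 := tendsto_finsetProd (Finset.univ : Finset (Fin (n + 1))) fun j _ =>
    tendsto_div_of_tendsto hfm hfpos hfreg (norm_pos_iff.2 hx)
      (tendsto_add_inv_smul x ((Fin.cons 0 z : Fin (n + 1) → Euc d) j)).norm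
  have t4 := ((t1.mul_const (h (padFirst k z))).mul
    (t2.mul_const (h (padSecond k ℓ z)))).mul t3
  rw [Finset.prod_const, Finset.card_univ, Fintype.card_fin,
    ← Real.rpow_mul_natCast (norm_nonneg _), neg_mul] at t4
  rw [show φ₁ (fun _ => x) * φ₂ (fun _ => x) * ‖x‖ ^ (-(α * ((n + 1 : ℕ) : ℝ))) *
      (h (padFirst k z) * h (padSecond k ℓ z)) = φ₁ (fun _ => x) * h (padFirst k z) *
        (φ₂ (fun _ => x) * h (padSecond k ℓ z)) * ‖x‖ ^ (-(α * ((n + 1 : ℕ) : ℝ))) by ring]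
  exact t4

theorem norm_le_of_apply_ne_zero {k : ℕ} {h : (Fin k → Euc d) → ℝ} {L : ℝ}
    (hhdiam : ∀ y : Fin k → Euc d, (∃ i j, L < dist (y i) (y j)) → h y = 0)
    {y : Fin k → Euc d} (hy : h y ≠ 0) {i₀ : Fin k} (hi₀ : y i₀ = 0) (i : Fin k) :
    ‖y i‖ ≤ L := by
  by_contra! hlt
  exact hy (hhdiam y ⟨i, i₀, by rwa [hi₀, dist_zero_right]⟩)

theorem exists_integrable_bound_rescaledIntegrand {k ℓ : ℕ} (hℓ : 1 ≤ ℓ) (hℓk : ℓ ≤ k)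
    (hn : 2 * k - ℓ = n + 1) {α : ℝ} (hα : (d : ℝ) < α)
    {f : ℝ → ℝ} (hfm : Measurable f) (hfnn : ∀ r, 0 ≤ f r)
    (hfpos : ∀ᶠ r in atTop, 0 < f r)
    (hfreg : ∀ r : ℝ, 0 < r → Tendsto (fun t => f (t * r) / f t) atTop (𝓝 (r ^ (-α))))
    {h : (Fin k → Euc d) → ℝ} (hh01 : ∀ y, h y = 0 ∨ h y = 1)
    {L : ℝ} (hhdiam : ∀ y : Fin k → Euc d, (∃ i j, L < dist (y i) (y j)) → h y = 0)
    {φ₁ φ₂ : (Fin k → Euc d) → ℝ} (hφ₁nn : ∀ x, 0 ≤ φ₁ x) (hφ₂nn : ∀ x, 0 ≤ φ₂ x)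
    (hφ₁b : ∃ M, ∀ x, φ₁ x ≤ M) (hφ₂b : ∃ M, ∀ x, φ₂ x ≤ M)
    (hφ₁0 : ∃ a > 0, ∀ x : Fin k → Euc d, (∃ i, ‖x i‖ ≤ a) → φ₁ x = 0)
    (hφ₂0 : ∃ a > 0, ∀ x : Fin k → Euc d, (∃ i, ‖x i‖ ≤ a) → φ₂ x = 0) :
    ∃ b : Euc d × (Fin n → Euc d) → ℝ, Integrable b (volume.prod volume) ∧
      ∀ᶠ R in atTop, ∀ p, ‖rescaledIntegrand k ℓ f h φ₁ φ₂ R p‖ ≤ b p := by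
  obtain ⟨M₁, hM₁⟩ := hφ₁b
  obtain ⟨M₂, hM₂⟩ := hφ₂b
  obtain ⟨a₁, ha₁, hφ₁0⟩ := hφ₁0
  obtain ⟨a₂, ha₂, hφ₂0⟩ := hφ₂0
  have hM₁0 : 0 ≤ M₁ := (hφ₁nn 0).trans (hM₁ 0)
  have hM₂0 : 0 ≤ M₂ := (hφ₂nn 0).trans (hM₂ 0)
  set a := min a₁ a₂
  have ha : 0 < a := lt_min ha₁ ha₂
  obtain ⟨β, hβd, hβα⟩ := exists_between hα
  have hβ : 0 < β := (Nat.cast_nonneg d).trans_lt hβd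
  obtain ⟨C, hC, hpot⟩ := exists_div_le_mul_one_add_rpow hfm hfpos hfreg hβ hβα ha
  set K := M₁ * M₂ * C ^ (n + 1)
  have hK : 0 ≤ K := by positivity
  set B : Set (Fin n → Euc d) := Metric.closedBall 0 (max L 0)
  refine ⟨fun p => (K * (1 + ‖p.1‖) ^ (-β)) * B.indicator 1 p.2, ?_, ?_⟩
  · refine Integrable.mul_prod (f := fun x : Euc d => K * (1 + ‖x‖) ^ (-β))
      (g := B.indicator (1 : (Fin n → Euc d) → ℝ)) ?_ ?_
    · exact (integrable_one_add_norm (by simpa using hβd)).const_mul K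
    · exact (integrable_indicator_iff Metric.isClosed_closedBall.measurableSet).2
        (integrableOn_const (isCompact_closedBall _ _).measure_lt_top.ne)
  filter_upwards [hpot, hfpos] with R hR hfR
  rintro ⟨x, z⟩
  have hbnn : 0 ≤ (K * (1 + ‖x‖) ^ (-β)) * B.indicator (1 : (Fin n → Euc d) → ℝ) z :=
    mul_nonneg (by positivity) (Set.indicator_nonneg (fun _ _ => zero_le_one) _)
  simp only [rescaledIntegrand]
  set u : Fin k → Euc d := fun i => x + R⁻¹ • padFirst k z i
  set v : Fin k → Euc d := fun i => x + R⁻¹ • padSecond k ℓ z i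
  set c : Fin (n + 1) → Euc d := Fin.cons 0 z
  by_cases h1 : φ₁ u = 0
  · simpa [h1] using hbnn
  by_cases h2 : φ₂ v = 0
  · simpa [h2] using hbnn
  by_cases h3 : h (padFirst k z) = 0
  · simpa [h3] using hbnn
  by_cases h4 : h (padSecond k ℓ z) = 0
  · simpa [h4] using hbnn
  have hcL : ∀ j, ‖c j‖ ≤ L := fun j => by
    rcases exists_padFirst_or_padSecond_eq hℓ hℓk hn z j with ⟨i, hi⟩ | ⟨i, hi⟩
    · simp only [c, ← hi]
      exact norm_le_of_apply_ne_zero hhdiam h3 (i₀ := ⟨0, by omega⟩) rfl i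
    · simp only [c, ← hi]
      exact norm_le_of_apply_ne_zero hhdiam h4 (i₀ := ⟨0, by omega⟩) rfl i
  have hca : ∀ j, a ≤ ‖x + R⁻¹ • c j‖ := fun j => by
    by_contra! hlt
    rcases exists_padFirst_or_padSecond_eq hℓ hℓk hn z j with ⟨i, hi⟩ | ⟨i, hi⟩
    · exact h1 (hφ₁0 u ⟨i, by simp only [u, hi]; exact hlt.le.trans (min_le_left _ _)⟩)
    · exact h2 (hφ₂0 v ⟨i, by simp only [v, hi]; exact hlt.le.trans (min_le_right _ _)⟩)
  have hzB : z ∈ B := by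
    rw [mem_closedBall_zero_iff, pi_norm_le_iff_of_nonneg (le_max_right _ _)]
    exact fun i => (hcL i.succ).trans (le_max_left _ _)
  have hh3 := (hh01 (padFirst k z)).resolve_left h3
  have hh4 := (hh01 (padSecond k ℓ z)).resolve_left h4
  have hq0 : ∀ j, 0 ≤ f (R * ‖x + R⁻¹ • c j‖) / f R := fun j => div_nonneg (hfnn _) (hfnn _)
  have hqC : ∀ j, f (R * ‖x + R⁻¹ • c j‖) / f R ≤ C := fun j =>
    (hR _ (hca j)).trans (mul_le_of_le_one_right hC.le
      (Real.rpow_le_one_of_one_le_of_nonpos (by linarith [norm_nonneg (x + R⁻¹ • c j)])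
        (by linarith)))
  have hprod : ∏ j, f (R * ‖x + R⁻¹ • c j‖) / f R ≤ C ^ (n + 1) * (1 + ‖x‖) ^ (-β) := by
    rw [Fin.prod_univ_succ]
    have e0 := hR _ (hca 0)
    have hc0 : x + R⁻¹ • c 0 = x := by simp [c]
    have e1 : ∏ j : Fin n, f (R * ‖x + R⁻¹ • c j.succ‖) / f R ≤ C ^ n := by
      simpa using Finset.prod_le_prod (s := Finset.univ)
        (fun (j : Fin n) _ => hq0 j.succ) (fun j _ => hqC j.succ)
    refine (mul_le_mul e0 e1 (Finset.prod_nonneg fun j _ => hq0 _) (by positivity)).trans_eq ?_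
    rw [hc0]
    ring
  rw [hh3, hh4, mul_one, mul_one, Set.indicator_of_mem hzB, Pi.one_apply, mul_one,
    Real.norm_of_nonneg (mul_nonneg (mul_nonneg (hφ₁nn _) (hφ₂nn _))
      (Finset.prod_nonneg fun j _ => hq0 j))]
  calc _ ≤ (M₁ * M₂) * (C ^ (n + 1) * (1 + ‖x‖) ^ (-β)) :=
        mul_le_mul (mul_le_mul (hM₁ _) (hM₂ _) (hφ₂nn _) hM₁0) hprod
          (Finset.prod_nonneg fun j _ => hq0 j) (by positivity)
    _ = _ := by ring

end Shift

/-- the key covariance limit (6.10) in the proof of Lemma 6.1(ii). -/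
theorem layered_overlap_asymptotics
    (d k ℓ : ℕ) (hd : 1 ≤ d) (hk : 1 ≤ k) (hℓ1 : 1 ≤ ℓ) (hℓk : ℓ ≤ k)
    (α : ℝ) (hα : (d : ℝ) < α)
    (f : ℝ → ℝ) (hfm : Measurable f) (hfnn : ∀ r, 0 ≤ f r)
    (hfprob : (∫ x : Euc d, f ‖x‖) = 1)
    (hfpos : ∀ᶠ r in atTop, 0 < f r)
    (hfreg : ∀ r : ℝ, 0 < r → Tendsto (fun t => f (t * r) / f t) atTop (𝓝 (r ^ (-α))))
    (h : (Fin k → Euc d) → ℝ) (hhm : Measurable h)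
    (hh01 : ∀ y, h y = 0 ∨ h y = 1)
    (hhperm : ∀ (σ : Equiv.Perm (Fin k)) (y : Fin k → Euc d), h (y ∘ σ) = h y)
    (hhtrans : ∀ (x : Euc d) (y : Fin k → Euc d), h (fun i => x + y i) = h y)
    (L : ℝ) (hL : 0 < L)
    (hhdiam : ∀ y : Fin k → Euc d, (∃ i j, L < dist (y i) (y j)) → h y = 0)
    (hh1 : k = 1 → ∀ y, h y = 1)
    (φ₁ : (Fin k → Euc d) → ℝ) (hφ₁c : Continuous φ₁) (hφ₁nn : ∀ x, 0 ≤ φ₁ x)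
    (hφ₁b : ∃ M, ∀ x, φ₁ x ≤ M)
    (hφ₁0 : ∃ a > 0, ∀ x : Fin k → Euc d, (∃ i, ‖x i‖ ≤ a) → φ₁ x = 0)
    (φ₂ : (Fin k → Euc d) → ℝ) (hφ₂c : Continuous φ₂) (hφ₂nn : ∀ x, 0 ≤ φ₂ x)
    (hφ₂b : ∃ M, ∀ x, φ₂ x ≤ M)
    (hφ₂0 : ∃ a > 0, ∀ x : Fin k → Euc d, (∃ i, ‖x i‖ ≤ a) → φ₂ x = 0) :
    Tendsto (fun R : ℝ =>
        (R ^ d * f R ^ (2 * k - ℓ))⁻¹ *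
          ∫ y : Fin (2 * k - ℓ) → Euc d,
            φ₁ (fun i : Fin k => R⁻¹ • sel1 k y i) * h (sel1 k y) *
              (φ₂ (fun i : Fin k => R⁻¹ • sel2 k ℓ y i) * h (sel2 k ℓ y)) *
              ∏ i, f ‖y i‖)
      atTop
      (𝓝 ((∫ z : Fin (2 * k - ℓ - 1) → Euc d, h (padFirst k z) * h (padSecond k ℓ z)) *
          ∫ x : Euc d, φ₁ (fun _ : Fin k => x) * φ₂ (fun _ : Fin k => x) *
            ‖x‖ ^ (-(α * ((2 * k - ℓ : ℕ) : ℝ))))) := by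
  obtain ⟨n, hn⟩ : ∃ n, 2 * k - ℓ = n + 1 := ⟨2 * k - ℓ - 1, by omega⟩
  rw [hn, Nat.add_sub_cancel]
  obtain ⟨b, hb, hFb⟩ := exists_integrable_bound_rescaledIntegrand (n := n) hℓ1 hℓk hn hα hfm hfnn
    hfpos hfreg hh01 hhdiam hφ₁nn hφ₂nn hφ₁b hφ₂b hφ₁0 hφ₂0
  rw [mul_comm, ← integral_prod_mul]
  have hx : ∀ᵐ p : Euc d × (Fin n → Euc d) ∂(volume.prod volume), p.1 ≠ 0 := by
    have : Nontrivial (Euc d) := by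
      have : NeZero d := ⟨by omega⟩
      infer_instance
    exact Measure.quasiMeasurePreserving_fst.ae (Measure.ae_ne volume 0)
  refine (tendsto_integral_filter_of_dominated_convergence b
    (Eventually.of_forall fun R => (measurable_rescaledIntegrand k ℓ hfm hhm hφ₁c.measurable
      hφ₂c.measurable R).aestronglyMeasurable)
    (hFb.mono fun R hR => Eventually.of_forall hR) hb
    (hx.mono fun p hp =>
      tendsto_rescaledIntegrand k ℓ hfm hfpos hfreg h hφ₁c hφ₂c hp p.2)).congr' ?_
  filter_upwards [eventually_gt_atTop 0] with R hR
  exact (inv_mul_integral_eq_integral_rescaledIntegrand hℓ1 hℓk hn hfm hhm hφ₁c.measurable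
    hφ₂c.measurable hhtrans hR).symm
end
end

section
/- As n → ∞, (n^k/(k!·m^k)) ∫_{(ℝ^d)^k} φ(y_1/R_k(C_k n/m), …, y_k/R_k(C_k n/m)) h_k(y_1,…,y_k) Π_{i=1}^k f(y_i) dy converges to μ_k(φ) := ((αk−d)/s_{d−1}) ∫_{ℝ^d} φ(x,…,x) |x|^{−αk} dx. (By the multivariate Mecke formula for the Poisson process with intensity n f, the left-hand side equals m^{−k} E[ν_{k,n}(φ)], the normalized mean of the layered tail empirical measure.) -/
open MeasureTheory Filter Topology

noncomputable section

/-- The uniform convergence theorem for additively slowly varying measurable functions. -/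
theorem exists_forall_abs_sub_le_of_tendsto {g : ℝ → ℝ} (hg : Measurable g)
    (hlim : ∀ t, Tendsto (fun u => g (u + t) - g u) atTop (𝓝 0)) {δ : ℝ} (hδ : 0 < δ) :
    ∃ U, ∀ u ≥ U, ∀ t ∈ Set.Icc (0 : ℝ) 1, |g (u + t) - g u| ≤ δ := by
  set F : ℝ → ℝ → ℝ := fun u s => min 1 |g (u + s) - g u| with hF
  have hFm : ∀ u, Measurable (F u) := fun u => by
    simp only [hF]; fun_prop
  have hF0 : ∀ u s, 0 ≤ F u s := fun u s => le_min zero_le_one (abs_nonneg _)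
  have hF1 : ∀ u s, F u s ≤ 1 := fun u s => min_le_left _ _
  have hFi : ∀ u a b, IntervalIntegrable (F u) volume a b := fun u a b =>
    (intervalIntegrable_const (c := (1 : ℝ))).mono_fun (hFm u).aestronglyMeasurable
      (ae_of_all _ fun s => by
        simpa [Real.norm_of_nonneg (hF0 u s)] using hF1 u s)
  have hI : Tendsto (fun u => ∫ s in (0 : ℝ)..2, F u s) atTop (𝓝 0) := by
    have := intervalIntegral.tendsto_integral_filter_of_dominated_convergence
      (μ := volume) (a := (0 : ℝ)) (b := 2) (F := F) (f := fun _ => (0 : ℝ)) (l := atTop)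
      (fun _ => (1 : ℝ))
      (Eventually.of_forall fun u => (hFm u).aestronglyMeasurable)
      (Eventually.of_forall fun u => ae_of_all _ fun s _ => by
        rw [Real.norm_of_nonneg (hF0 u s)]; exact hF1 u s)
      intervalIntegrable_const
      (ae_of_all _ fun s _ => by
        have := (tendsto_const_nhds (x := (1 : ℝ))).min (hlim s).abs
        simpa using this)
    simpa using this
  have hε : 0 < min δ 1 / 3 := by positivity
  obtain ⟨U, hU⟩ := eventually_atTop.1 (hI.eventually (gt_mem_nhds hε))
  refine ⟨U, fun u hu t ht => ?_⟩
  have hkey : F u t ≤ (∫ s in (0 : ℝ)..2, F u s) + ∫ s in (0 : ℝ)..2, F (u + t) s := by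
    have h1 : (∫ s in (1 : ℝ)..2, F u s) ≤ ∫ s in (0 : ℝ)..2, F u s :=
      intervalIntegral.integral_mono_interval zero_le_one one_le_two le_rfl
        (ae_of_all _ (hF0 u)) (hFi _ _ _)
    have h2 : (∫ s in (1 : ℝ)..2, F (u + t) (s - t)) ≤ ∫ s in (0 : ℝ)..2, F (u + t) s := by
      rw [intervalIntegral.integral_comp_sub_right]
      exact intervalIntegral.integral_mono_interval (by linarith [ht.2]) (by linarith)
        (by linarith [ht.1]) (ae_of_all _ (hF0 _)) (hFi _ _ _)
    have hi2 : IntervalIntegrable (fun s => F (u + t) (s - t)) volume 1 2 := by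
      have := (hFi (u + t) (1 - t) (2 - t)).comp_sub_right t
      simpa using this
    have h3 : F u t ≤ ∫ s in (1 : ℝ)..2, (F u s + F (u + t) (s - t)) := by
      have : F u t = ∫ s in (1 : ℝ)..2, F u t := by
        rw [intervalIntegral.integral_const]; norm_num
      rw [this]
      refine intervalIntegral.integral_mono_on one_le_two intervalIntegrable_const
        ((hFi _ _ _).add hi2) fun s _ => ?_
      simp only [hF]
      rw [show u + t + (s - t) = u + s by ring]
      have h4 : |g (u + t) - g u| ≤ |g (u + s) - g u| + |g (u + s) - g (u + t)| := by
        rw [abs_sub_comm (g (u + s)) (g (u + t))]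
        linarith [abs_sub_le (g (u + t)) (g (u + s)) (g u)]
      have := abs_nonneg (g (u + s) - g u)
      have := abs_nonneg (g (u + s) - g (u + t))
      rcases le_total 1 |g (u + s) - g u| with h5 | h5 <;>
      rcases le_total 1 |g (u + s) - g (u + t)| with h6 | h6 <;>
      simp only [min_eq_left h5, min_eq_left h6, min_eq_right h5, min_eq_right h6] <;>
      first
        | exact (min_le_left _ _).trans (by linarith)
        | exact (min_le_right _ _).trans h4
    rw [intervalIntegral.integral_add (hFi _ _ _) hi2] at h3
    linarith
  have h1 := hU u hu
  have h2 := hU (u + t) (by linarith [ht.1])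
  have h3 : F u t < min δ 1 := by linarith
  rcases min_lt_iff.1 h3 with h4 | h4
  · exact absurd (h4.trans_le (min_le_right _ _)) (lt_irrefl _)
  · exact (h4.trans_le (min_le_left _ _)).le

/-- An additive form of Potter's bounds. -/
theorem exists_forall_abs_sub_le_mul_of_tendsto {g : ℝ → ℝ} (hg : Measurable g)
    (hlim : ∀ t, Tendsto (fun u => g (u + t) - g u) atTop (𝓝 0)) {δ : ℝ} (hδ : 0 < δ) :
    ∃ U, ∀ u ≥ U, ∀ v ≥ U, |g v - g u| ≤ δ * (|v - u| + 1) := by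
  obtain ⟨U, hU⟩ := exists_forall_abs_sub_le_of_tendsto hg hlim hδ
  have hnat : ∀ n : ℕ, ∀ u ≥ U, ∀ t ∈ Set.Icc (0 : ℝ) 1,
      |g (u + n + t) - g u| ≤ δ * (n + 1) := by
    intro n
    induction n with
    | zero => intro u hu t ht; simpa using hU u hu t ht
    | succ n ih =>
      intro u hu t ht
      have h1 := ih (u + 1) (by linarith) t ht
      have h2 := hU u hu 1 ⟨zero_le_one, le_rfl⟩
      rw [show u + 1 + n + t = u + (n + 1 : ℕ) + t by push_cast; ring] at h1
      have h3 := abs_sub_le (g (u + (n + 1 : ℕ) + t)) (g (u + 1)) (g u)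
      push_cast at *
      linarith
  have hle : ∀ u ≥ U, ∀ v, u ≤ v → |g v - g u| ≤ δ * (|v - u| + 1) := by
    intro u hu v huv
    have h0 : 0 ≤ v - u := sub_nonneg.2 huv
    have h1 := hnat ⌊v - u⌋₊ u hu (v - u - ⌊v - u⌋₊)
      ⟨by linarith [Nat.floor_le h0], by linarith [Nat.lt_floor_add_one (v - u)]⟩
    rw [show u + ⌊v - u⌋₊ + (v - u - ⌊v - u⌋₊) = v by ring] at h1
    refine h1.trans ?_
    rw [abs_of_nonneg h0]
    gcongr
    exact Nat.floor_le h0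
  refine ⟨U, fun u hu v hv => ?_⟩
  rcases le_total u v with huv | huv
  · exact hle u hu v huv
  · rw [abs_sub_comm (g v), abs_sub_comm v]
    exact hle v hv u huv

/-- Potter's bounds for a regularly varying function. -/
theorem exists_forall_abs_log_div_le {f : ℝ → ℝ} {α : ℝ} (hfm : Measurable f)
    (hfpos : ∀ᶠ r in atTop, 0 < f r)
    (hfreg : ∀ r : ℝ, 0 < r → Tendsto (fun t => f (t * r) / f t) atTop (𝓝 (r ^ (-α))))
    {δ : ℝ} (hδ : 0 < δ) :
    ∃ T > 0, ∀ r ≥ T, ∀ s ≥ T, 0 < f r ∧ 0 < f s ∧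
      |Real.log (f s / f r) + α * Real.log (s / r)| ≤ δ * (|Real.log (s / r)| + 1) := by
  set g : ℝ → ℝ := fun u => Real.log (f (Real.exp u)) + α * u with hgdef
  have hg : Measurable g := by simp only [hgdef]; fun_prop
  have hlim : ∀ t, Tendsto (fun u => g (u + t) - g u) atTop (𝓝 0) := by
    intro t
    have h1 := ((hfreg (Real.exp t) (Real.exp_pos t)).comp Real.tendsto_exp_atTop).log
      (Real.rpow_pos_of_pos (Real.exp_pos t) _).ne'
    rw [Real.log_rpow (Real.exp_pos t), Real.log_exp] at h1
    have h2 := h1.add_const (α * t)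
    rw [show -α * t + α * t = 0 by ring] at h2
    refine h2.congr' ?_
    filter_upwards [Real.tendsto_exp_atTop.eventually hfpos,
      (Real.tendsto_exp_atTop.comp (tendsto_atTop_add_const_right _ t tendsto_id)).eventually
        hfpos] with u hu hu'
    simp only [Function.comp_apply, id] at hu'
    simp only [Function.comp_apply, hgdef]
    rw [← Real.exp_add, Real.log_div hu'.ne' hu.ne']
    ring
  obtain ⟨U, hU⟩ := exists_forall_abs_sub_le_mul_of_tendsto hg hlim hδ
  obtain ⟨T, hT⟩ := eventually_atTop.1 hfpos
  refine ⟨max (Real.exp U) T, (Real.exp_pos U).trans_le (le_max_left _ _),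
    fun r hr s hs => ?_⟩
  have hr0 : 0 < r := (Real.exp_pos U).trans_le ((le_max_left _ _).trans hr)
  have hs0 : 0 < s := (Real.exp_pos U).trans_le ((le_max_left _ _).trans hs)
  have hfr := hT r ((le_max_right _ _).trans hr)
  have hfs := hT s ((le_max_right _ _).trans hs)
  refine ⟨hfr, hfs, ?_⟩
  have := hU (Real.log r) ((Real.le_log_iff_exp_le hr0).2 ((le_max_left _ _).trans hr))
    (Real.log s) ((Real.le_log_iff_exp_le hs0).2 ((le_max_left _ _).trans hs))
  simp only [hgdef, Real.exp_log hr0, Real.exp_log hs0] at this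
  rw [Real.log_div hfs.ne' hfr.ne', Real.log_div hs0.ne' hr0.ne']
  convert this using 2
  ring

/-- Regular variation along a moving ratio. -/
theorem tendsto_div_of_regularlyVarying {f : ℝ → ℝ} {α : ℝ} (hfm : Measurable f)
    (hfpos : ∀ᶠ r in atTop, 0 < f r)
    (hfreg : ∀ r : ℝ, 0 < r → Tendsto (fun t => f (t * r) / f t) atTop (𝓝 (r ^ (-α))))
    {q : ℝ → ℝ} {c : ℝ} (hc : 0 < c) (hq : Tendsto q atTop (𝓝 c)) :
    Tendsto (fun r => f (r * q r) / f r) atTop (𝓝 (c ^ (-α))) := by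
  have hs : Tendsto (fun r => r * q r) atTop atTop := tendsto_id.atTop_mul_pos hc hq
  have hlq : Tendsto (fun r => Real.log (q r)) atTop (𝓝 (Real.log c)) := hq.log hc.ne'
  have h0 : Tendsto (fun r => Real.log (f (r * q r) / f r) + α * Real.log (q r)) atTop (𝓝 0) := by
    rw [Metric.tendsto_nhds]
    intro ε hε
    set B := |Real.log c| + 1 with hB
    have hB0 : 0 < B := by positivity
    obtain ⟨T, hT0, hT⟩ := exists_forall_abs_log_div_le hfm hfpos hfreg
      (δ := ε / (2 * (B + 1))) (by positivity)
    filter_upwards [eventually_ge_atTop T, hs.eventually_ge_atTop T,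
      hlq.abs.eventually (gt_mem_nhds (show |Real.log c| < B by linarith))] with r hr hsr hl
    have := (hT r hr _ hsr).2.2
    rw [mul_div_cancel_left₀ _ (hT0.trans_le hr).ne'] at this
    rw [Real.dist_0_eq_abs]
    calc _ ≤ _ := this
      _ ≤ ε / (2 * (B + 1)) * (B + 1) := by gcongr
      _ = ε / 2 := by field_simp
      _ < ε := by linarith
  have h1 : Tendsto (fun r => Real.log (f (r * q r) / f r)) atTop (𝓝 (-α * Real.log c)) := by
    have := h0.sub (hlq.const_mul α)
    simp only [add_sub_cancel_right] at this
    convert this using 2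
    ring
  have h2 := h1.rexp
  rw [mul_comm, ← Real.rpow_def_of_pos hc] at h2
  refine h2.congr' ?_
  filter_upwards [hfpos, hs.eventually hfpos] with r hr hr'
  exact Real.exp_log (div_pos hr' hr)

/-- An upper Potter bound in a form suited to integration against Lebesgue measure. -/
theorem exists_forall_div_le_one_add_rpow {f : ℝ → ℝ} {α β : ℝ} (hβ0 : 0 < β) (hβ : β < α)
    (hfm : Measurable f) (hfpos : ∀ᶠ r in atTop, 0 < f r)
    (hfreg : ∀ r : ℝ, 0 < r → Tendsto (fun t => f (t * r) / f t) atTop (𝓝 (r ^ (-α))))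
    {a : ℝ} (ha : 0 < a) :
    ∃ C > 0, ∃ T > 0, ∀ r ≥ T, ∀ q > a, f (r * q) / f r ≤ C * (1 + q) ^ (-β) := by
  set δ := α - β with hδdef
  have hδ : 0 < δ := sub_pos.2 hβ
  obtain ⟨T, hT0, hT⟩ := exists_forall_abs_log_div_le hfm hfpos hfreg hδ
  refine ⟨Real.exp δ * (1 + a ^ (-(2 * δ))) * (1 + a⁻¹) ^ β, by positivity,
    max T (T / a), lt_max_of_lt_left hT0, fun r hr q hq => ?_⟩
  have hq0 : 0 < q := ha.trans hq
  have hrT : T ≤ r := (le_max_left _ _).trans hr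
  have hr0 : 0 < r := hT0.trans_le hrT
  have hrq : T ≤ r * q := by
    have h1 : T ≤ r * a := (div_le_iff₀ ha).1 ((le_max_right _ _).trans hr)
    exact h1.trans (by gcongr)
  obtain ⟨h1, h2, h3⟩ := hT r hrT _ hrq
  rw [mul_div_cancel_left₀ _ hr0.ne'] at h3
  have h4 := (abs_le.1 h3).2
  have h5 : f (r * q) / f r ≤ Real.exp δ * Real.exp (δ * |Real.log q|) * q ^ (-α) := by
    rw [← Real.exp_log (div_pos h2 h1), Real.rpow_def_of_pos hq0, ← Real.exp_add, ← Real.exp_add]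
    apply Real.exp_le_exp.2
    linarith
  have h6 : Real.exp (δ * |Real.log q|) ≤ (1 + a ^ (-(2 * δ))) * q ^ δ := by
    rcases le_total 0 (Real.log q) with hl | hl
    · rw [abs_of_nonneg hl, mul_comm δ, ← Real.rpow_def_of_pos hq0]
      have : 0 ≤ a ^ (-(2 * δ)) * q ^ δ := by positivity
      linarith
    · rw [abs_of_nonpos hl, show δ * -Real.log q = Real.log q * -δ by ring,
        ← Real.rpow_def_of_pos hq0, show -δ = -(2 * δ) + δ by ring, Real.rpow_add hq0]
      have : q ^ (-(2 * δ)) ≤ a ^ (-(2 * δ)) :=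
        Real.rpow_le_rpow_of_nonpos ha hq.le (by linarith)
      gcongr
      linarith
  have h7 : q ^ (-β) ≤ (1 + a⁻¹) ^ β * (1 + q) ^ (-β) := by
    have h8 : (1 + q) ^ β ≤ ((1 + a⁻¹) * q) ^ β := by
      gcongr
      have : 1 ≤ a⁻¹ * q := by
        rw [inv_mul_eq_div, one_le_div ha]; exact hq.le
      linarith
    rw [Real.mul_rpow (by positivity) hq0.le] at h8
    rw [Real.rpow_neg hq0.le, Real.rpow_neg (by positivity), ← div_eq_mul_inv, ← one_div,
      div_le_div_iff₀ (by positivity) (by positivity)]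
    linarith
  calc f (r * q) / f r ≤ Real.exp δ * Real.exp (δ * |Real.log q|) * q ^ (-α) := h5
    _ ≤ Real.exp δ * ((1 + a ^ (-(2 * δ))) * q ^ δ) * q ^ (-α) := by gcongr
    _ = Real.exp δ * (1 + a ^ (-(2 * δ))) * q ^ (-β) := by
        rw [show -β = δ + -α by rw [hδdef]; ring, Real.rpow_add hq0]; ring
    _ ≤ Real.exp δ * (1 + a ^ (-(2 * δ))) * ((1 + a⁻¹) ^ β * (1 + q) ^ (-β)) := by gcongr
    _ = _ := by ring

theorem padFirst_succ {d n : ℕ} (z : Fin n → Euc d) :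
    padFirst (n + 1) z = Fin.cons 0 z := by
  funext j
  refine Fin.cases ?_ (fun i => ?_) j
  · simp [padFirst]
  · simp [padFirst, vget]

theorem measurable_padFirst_succ {d n : ℕ} :
    Measurable (padFirst (n + 1) : (Fin n → Euc d) → Fin (n + 1) → Euc d) := by
  refine measurable_pi_iff.2 fun j => ?_
  simp only [padFirst_succ]
  refine Fin.cases ?_ (fun i => ?_) j
  · simp
  · simpa using measurable_pi_apply i

theorem measurable_smul_add_padFirst {d n : ℕ} (R : ℝ) :
    Measurable fun (p : Euc d × (Fin n → Euc d)) (i : Fin (n + 1)) =>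
      R • p.1 + padFirst (n + 1) p.2 i :=
  measurable_pi_iff.2 fun i => (measurable_fst.const_smul R).add
    ((measurable_pi_apply i).comp (measurable_padFirst_succ.comp measurable_snd))

theorem map_smul_add_padFirst {d n : ℕ} {R : ℝ} (hR : 0 < R) :
    Measure.map (fun (p : Euc d × (Fin n → Euc d)) (i : Fin (n + 1)) =>
      R • p.1 + padFirst (n + 1) p.2 i) (volume.prod volume) =
      ENNReal.ofReal (R ^ d)⁻¹ • volume := by
  have h1 : Measure.map (Prod.map (fun x : Euc d => R • x) (id : (Fin n → Euc d) → _))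
      (volume.prod volume) = ENNReal.ofReal (R ^ d)⁻¹ • volume.prod volume := by
    rw [← Measure.map_prod_map _ _ (measurable_const_smul R) measurable_id,
      Measure.map_addHaar_smul _ hR.ne', Measure.map_id, Measure.prod_smul_left,
      finrank_euclideanSpace_fin, abs_of_pos (by positivity)]
  have h2 : MeasurePreserving (fun p : Euc d × (Fin n → Euc d) => (p.1, fun i => p.1 + p.2 i))
      (volume.prod volume) (volume.prod volume) := by
    refine (MeasurePreserving.id volume).skew_product (g := fun (x : Euc d) (z : Fin n → Euc d) i => x + z i)
      (by unfold Function.uncurry; fun_prop) (ae_of_all _ fun x => ?_)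
    exact map_add_left_eq_self volume (fun _ : Fin n => x)
  have h3 := (volume_preserving_piFinSuccAbove (fun _ : Fin (n + 1) => Euc d) 0).symm
  have h4 := h3.comp h2
  have heq : (fun (p : Euc d × (Fin n → Euc d)) (i : Fin (n + 1)) =>
      R • p.1 + padFirst (n + 1) p.2 i) =
      ((MeasurableEquiv.piFinSuccAbove (fun _ : Fin (n + 1) => Euc d) 0).symm ∘
        fun p : Euc d × (Fin n → Euc d) => (p.1, fun i => p.1 + p.2 i)) ∘
      Prod.map (fun x : Euc d => R • x) id := by
    funext p i
    refine Fin.cases ?_ (fun i => ?_) i <;>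
      simp [padFirst_succ, MeasurableEquiv.piFinSuccAbove]
  rw [heq, ← Measure.map_map h4.measurable
    ((measurable_const_smul R).prodMap measurable_id), h1, Measure.map_smul, h4.map_eq]

/-- Integration over `(n + 1)`-tuples in coordinates relative to the first point, which is
rescaled by `R`. -/
theorem integral_eq_integral_smul_add_padFirst {d n : ℕ} {R : ℝ} (hR : 0 < R)
    {F : (Fin (n + 1) → Euc d) → ℝ} (hF : Measurable F) :
    ∫ y, F y = R ^ d * ∫ p : Euc d × (Fin n → Euc d),
      F (fun i => R • p.1 + padFirst (n + 1) p.2 i) := by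
  rw [Measure.volume_eq_prod, ← integral_map (measurable_smul_add_padFirst R).aemeasurable
    hF.aestronglyMeasurable, map_smul_add_padFirst hR, integral_smul_measure,
    ENNReal.toReal_ofReal (by positivity), smul_eq_mul, mul_inv_cancel_left₀ (by positivity)]

/-- A bounded measurable function on tuples which only charges tuples of diameter at most `L` is
integrable once the first point is pinned at the origin. -/
theorem integrable_comp_padFirst {d n : ℕ} {h : (Fin (n + 1) → Euc d) → ℝ} {L : ℝ}
    (hhm : Measurable h) (hh01 : ∀ y, h y = 0 ∨ h y = 1)
    (hhdiam : ∀ y, (∃ i j, L < dist (y i) (y j)) → h y = 0) :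
    Integrable fun z : Fin n → Euc d => h (padFirst (n + 1) z) := by
  have hsupp : ∀ z : Fin n → Euc d, z ∉ Metric.closedBall (0 : Fin n → Euc d) (max L 0) →
      h (padFirst (n + 1) z) = 0 := by
    intro z hz
    apply hhdiam
    by_contra! hcon
    apply hz
    rw [mem_closedBall_zero_iff, pi_norm_le_iff_of_nonneg (le_max_right _ _)]
    intro i
    have := hcon i.succ 0
    simp only [padFirst_succ, Fin.cons_succ, Fin.cons_zero, dist_zero_right] at this
    exact this.trans (le_max_left _ _)
  refine IntegrableOn.integrable_of_forall_notMem_eq_zero (s := Metric.closedBall 0 (max L 0))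
    ?_ hsupp
  refine Measure.integrableOn_of_bounded (M := 1) measure_closedBall_lt_top.ne
    (hhm.comp measurable_padFirst_succ).aestronglyMeasurable (ae_of_all _ fun z => ?_)
  rcases hh01 (padFirst (n + 1) z) with h0 | h0 <;> simp [h0]

/-- The rescaled integrals converge by dominated convergence. -/
theorem tendsto_integral_rescaled {d n : ℕ} (hd : 1 ≤ d) {α : ℝ} (hα : (d : ℝ) < α)
    {f : ℝ → ℝ} (hfm : Measurable f) (hfnn : ∀ r, 0 ≤ f r)
    (hfpos : ∀ᶠ r in atTop, 0 < f r)
    (hfreg : ∀ r : ℝ, 0 < r → Tendsto (fun t => f (t * r) / f t) atTop (𝓝 (r ^ (-α))))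
    {h : (Fin (n + 1) → Euc d) → ℝ} (hhm : Measurable h) (hh01 : ∀ y, h y = 0 ∨ h y = 1)
    {L : ℝ} (hhdiam : ∀ y, (∃ i j, L < dist (y i) (y j)) → h y = 0)
    {φ : (Fin (n + 1) → Euc d) → ℝ} (hφc : Continuous φ) (hφnn : ∀ x, 0 ≤ φ x)
    {M : ℝ} (hφM : ∀ x, φ x ≤ M) {a : ℝ} (ha : 0 < a)
    (hφ0 : ∀ x, (∃ i, ‖x i‖ ≤ a) → φ x = 0) :
    Tendsto (fun R : ℝ => ∫ p : Euc d × (Fin n → Euc d),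
        φ (fun i => p.1 + R⁻¹ • padFirst (n + 1) p.2 i) * h (padFirst (n + 1) p.2) *
          ∏ i, f ‖R • p.1 + padFirst (n + 1) p.2 i‖ / f R) atTop
      (𝓝 ((∫ x : Euc d, φ (fun _ => x) * ‖x‖ ^ (-(α * ((n + 1 : ℕ) : ℝ)))) *
        ∫ z : Fin n → Euc d, h (padFirst (n + 1) z))) := by
  rw [← integral_prod_mul, ← Measure.volume_eq_prod]
  set β := (d + α) / 2 with hβdef
  have hdpos : (0 : ℝ) < d := by exact_mod_cast hd
  have hβ0 : 0 < β := by linarith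
  have hβα : β < α := by linarith
  have hdβ : (d : ℝ) < β := by linarith
  obtain ⟨C, hC0, T, hT0, hT⟩ := exists_forall_div_le_one_add_rpow hβ0 hβα hfm hfpos hfreg ha
  have hM0 : 0 ≤ M := (hφnn 0).trans (hφM 0)
  have hh0 : ∀ y, 0 ≤ h y := fun y => by rcases hh01 y with h0 | h0 <;> simp [h0]
  have hnorm : ∀ {R : ℝ}, 0 < R → ∀ x w : Euc d, ‖R • x + w‖ = R * ‖x + R⁻¹ • w‖ := by
    intro R hR x w
    rw [← Real.norm_of_nonneg hR.le, ← norm_smul, Real.norm_of_nonneg hR.le, smul_add,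
      smul_inv_smul₀ hR.ne']
  refine tendsto_integral_filter_of_dominated_convergence
    (fun p : Euc d × (Fin n → Euc d) =>
      (M * C ^ (n + 1) * (1 + ‖p.1‖) ^ (-β)) * h (padFirst (n + 1) p.2)) ?_ ?_ ?_ ?_
  · refine Eventually.of_forall fun R => Measurable.aestronglyMeasurable ?_
    have hw : ∀ i, Measurable fun p : Euc d × (Fin n → Euc d) => padFirst (n + 1) p.2 i :=
      fun i => (measurable_pi_apply i).comp (measurable_padFirst_succ.comp measurable_snd)
    refine ((hφc.measurable.comp (measurable_pi_iff.2 fun i => ?_)).mul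
      (hhm.comp (measurable_padFirst_succ.comp measurable_snd))).mul
      (Finset.measurable_prod _ fun i _ => ?_)
    · exact measurable_fst.add ((hw i).const_smul R⁻¹ :)
    · exact (hfm.comp ((measurable_fst.const_smul R).add (hw i)).norm).div_const _
  · filter_upwards [eventually_ge_atTop T] with R hR
    refine ae_of_all _ fun p => ?_
    have hR0 : 0 < R := hT0.trans_le hR
    have hb : 0 ≤ (M * C ^ (n + 1) * (1 + ‖p.1‖) ^ (-β)) * h (padFirst (n + 1) p.2) :=
      mul_nonneg (by positivity) (hh0 _)
    by_cases hsmall : ∃ i, ‖p.1 + R⁻¹ • padFirst (n + 1) p.2 i‖ ≤ a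
    · rw [hφ0 _ hsmall]
      simpa using hb
    push Not at hsmall
    have hq : ∀ i, f ‖R • p.1 + padFirst (n + 1) p.2 i‖ / f R ≤
        C * (1 + ‖p.1 + R⁻¹ • padFirst (n + 1) p.2 i‖) ^ (-β) := fun i => by
      rw [hnorm hR0]
      exact hT R hR _ (hsmall i)
    have hq0 : ∀ i, 0 ≤ f ‖R • p.1 + padFirst (n + 1) p.2 i‖ / f R :=
      fun i => div_nonneg (hfnn _) (hfnn _)
    have hprod : ∏ i, f ‖R • p.1 + padFirst (n + 1) p.2 i‖ / f R ≤
        C ^ (n + 1) * (1 + ‖p.1‖) ^ (-β) := by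
      have h0 := hq 0
      simp only [padFirst_succ, Fin.cons_zero, smul_zero, add_zero] at h0
      rw [Fin.prod_univ_succ, pow_succ']
      have h1 : ∏ i : Fin n, f ‖R • p.1 + padFirst (n + 1) p.2 i.succ‖ / f R ≤ C ^ n := by
        refine (Finset.prod_le_prod (fun i _ => hq0 _) fun i _ => ?_).trans_eq
          (by simp : ∏ _i : Fin n, C = C ^ n)
        refine (hq i.succ).trans (mul_le_of_le_one_right hC0.le ?_)
        exact Real.rpow_le_one_of_one_le_of_nonpos (le_add_of_nonneg_right (norm_nonneg _))
          (by linarith)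
      calc _ ≤ (C * (1 + ‖p.1‖) ^ (-β)) * C ^ n := by
            refine mul_le_mul ?_ h1 (Finset.prod_nonneg fun i _ => hq0 _) (by positivity)
            simpa [padFirst_succ] using h0
        _ = _ := by ring
    have hP0 : 0 ≤ ∏ i, f ‖R • p.1 + padFirst (n + 1) p.2 i‖ / f R :=
      Finset.prod_nonneg fun i _ => hq0 i
    rw [Real.norm_of_nonneg (mul_nonneg (mul_nonneg (hφnn _) (hh0 _)) hP0)]
    calc _ ≤ M * h (padFirst (n + 1) p.2) * (C ^ (n + 1) * (1 + ‖p.1‖) ^ (-β)) := by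
          have := hh0 (padFirst (n + 1) p.2)
          have := hφM (fun i => p.1 + R⁻¹ • padFirst (n + 1) p.2 i)
          gcongr
      _ = _ := by ring
  · refine Integrable.mul_prod (f := fun x : Euc d => M * C ^ (n + 1) * (1 + ‖x‖) ^ (-β)) ?_
      (integrable_comp_padFirst hhm hh01 hhdiam)
    exact (integrable_one_add_norm (by simpa using hdβ)).const_mul _
  · refine ae_of_all _ fun p => ?_
    by_cases hpa : ‖p.1‖ ≤ a
    · have h1 : φ (fun _ => p.1) = 0 := hφ0 _ ⟨0, hpa⟩
      have h2 : ∀ R : ℝ, φ (fun i => p.1 + R⁻¹ • padFirst (n + 1) p.2 i) = 0 :=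
        fun R => hφ0 _ ⟨0, by simpa [padFirst_succ] using hpa⟩
      simp [h1, h2]
    have hp0 : 0 < ‖p.1‖ := ha.trans (not_le.1 hpa)
    have hshift : ∀ w : Euc d, Tendsto (fun R : ℝ => p.1 + R⁻¹ • w) atTop (𝓝 p.1) := fun w => by
      simpa using ((tendsto_inv_atTop_zero (𝕜 := ℝ)).smul_const w).const_add p.1
    have hφlim : Tendsto (fun R : ℝ => φ (fun i => p.1 + R⁻¹ • padFirst (n + 1) p.2 i)) atTop
        (𝓝 (φ fun _ => p.1)) :=
      (hφc.tendsto _).comp (tendsto_pi_nhds.2 fun i => hshift _)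
    have hflim : ∀ i, Tendsto (fun R : ℝ => f ‖R • p.1 + padFirst (n + 1) p.2 i‖ / f R) atTop
        (𝓝 (‖p.1‖ ^ (-α))) := fun i => by
      refine (tendsto_div_of_regularlyVarying hfm hfpos hfreg hp0
        (hshift (padFirst (n + 1) p.2 i)).norm).congr' ?_
      filter_upwards [eventually_gt_atTop 0] with R hR
      rw [hnorm hR]
    have hlim := (hφlim.mul_const (h (padFirst (n + 1) p.2))).mul
      (tendsto_finsetProd Finset.univ fun i _ => hflim i)
    convert hlim using 2
    rw [Finset.prod_const, Finset.card_univ, Fintype.card_fin, ← Real.rpow_natCast,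
      ← Real.rpow_mul hp0.le, neg_mul]
    ring

theorem sArea_pos {d : ℕ} (hd : 1 ≤ d) : 0 < sArea d := by
  unfold sArea
  have h1 : (0 : ℝ) < d := by exact_mod_cast hd
  exact mul_pos h1 (ENNReal.toReal_pos (Metric.measure_ball_pos volume _ one_pos).ne'
    measure_ball_lt_top.ne)

/-- Lemma 6.1(i), the normalized mean of the layered tail empirical measure. -/
theorem layered_mean_convergence
    (d k : ℕ) (hd : 1 ≤ d) (hk : 1 ≤ k) (α : ℝ) (hα : (d : ℝ) < α)
    (f : ℝ → ℝ) (hfm : Measurable f) (hfnn : ∀ r, 0 ≤ f r)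
    (hfprob : (∫ x : Euc d, f ‖x‖) = 1)
    (hfpos : ∀ᶠ r in atTop, 0 < f r)
    (hfreg : ∀ r : ℝ, 0 < r → Tendsto (fun t => f (t * r) / f t) atTop (𝓝 (r ^ (-α))))
    (h : (Fin k → Euc d) → ℝ) (hhm : Measurable h)
    (hh01 : ∀ y, h y = 0 ∨ h y = 1)
    (hhperm : ∀ (σ : Equiv.Perm (Fin k)) (y : Fin k → Euc d), h (y ∘ σ) = h y)
    (hhtrans : ∀ (x : Euc d) (y : Fin k → Euc d), h (fun i => x + y i) = h y)
    (L : ℝ) (hL : 0 < L)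
    (hhdiam : ∀ y : Fin k → Euc d, (∃ i j, L < dist (y i) (y j)) → h y = 0)
    (hh1 : k = 1 → ∀ y, h y = 1)
    (Ck : ℝ) (hCkpos : 0 < Ck)
    (hCkdef : Ck ^ k = sArea d / (Nat.factorial k) *
      ∫ z : Fin (k - 1) → Euc d, h (padFirst k z))
    (Rk : ℝ → ℝ) (hRkmono : MonotoneOn Rk (Set.Ici 0))
    (hRknn : ∀ t ∈ Set.Ici (0 : ℝ), 0 ≤ Rk t)
    (hRkinf : Tendsto Rk atTop atTop)
    (hRklim : Tendsto (fun t => t ^ k * Rk t ^ d * f (Rk t) ^ k) atTop (𝓝 (α * k - d)))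
    (m : ℕ → ℕ) (hm : Tendsto m atTop atTop)
    (hmn : Tendsto (fun n => (m n : ℝ) / n) atTop (𝓝 0))
    (φ : (Fin k → Euc d) → ℝ) (hφc : Continuous φ) (hφnn : ∀ x, 0 ≤ φ x)
    (hφb : ∃ M, ∀ x, φ x ≤ M)
    (hφ0 : ∃ a > 0, ∀ x : Fin k → Euc d, (∃ i, ‖x i‖ ≤ a) → φ x = 0) :
    Tendsto (fun n : ℕ =>
        ((n : ℝ) ^ k / (Nat.factorial k * (m n : ℝ) ^ k)) *
          ∫ y : Fin k → Euc d,
            φ (fun i => (Rk (Ck * n / m n))⁻¹ • y i) * h y * ∏ i, f ‖y i‖)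
      atTop
      (𝓝 ((α * k - d) / sArea d *
          ∫ x : Euc d, φ (fun _ : Fin k => x) * ‖x‖ ^ (-(α * (k : ℝ))))) := by
  obtain ⟨n, rfl⟩ : ∃ n, k = n + 1 := ⟨k - 1, by omega⟩
  obtain ⟨M, hφM⟩ := hφb
  obtain ⟨a, ha, hφ0⟩ := hφ0
  have hs := sArea_pos hd
  have hmpos : ∀ᶠ j in atTop, 0 < m j := hm.eventually_gt_atTop 0
  have ht : Tendsto (fun j : ℕ => Ck * j / m j) atTop atTop := by
    have h1 : Tendsto (fun j : ℕ => (m j : ℝ) / j) atTop (𝓝[>] 0) := by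
      refine tendsto_nhdsWithin_iff.2 ⟨hmn, ?_⟩
      filter_upwards [hmpos, eventually_gt_atTop 0] with j h1 h2
      rw [Set.mem_Ioi]
      positivity
    refine (h1.inv_tendsto_nhdsGT_zero.const_mul_atTop hCkpos).congr fun j => ?_
    simp only [Pi.inv_apply, inv_div, mul_div_assoc]
  have hR := hRkinf.comp ht
  have hmain := (tendsto_integral_rescaled hd hα hfm hfnn hfpos hfreg hhm hh01 hhdiam hφc hφnn
    hφM ha hφ0).comp hR
  have hlim := ((hRklim.comp ht).mul hmain).const_mul
    (1 / ((Nat.factorial (n + 1) : ℝ) * Ck ^ (n + 1)))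
  set H := ∫ z : Fin n → Euc d, h (padFirst (n + 1) z) with hH
  have hCk : Ck ^ (n + 1) = sArea d / (Nat.factorial (n + 1)) * H := hCkdef
  have hfac : (0 : ℝ) < Nat.factorial (n + 1) := by exact_mod_cast Nat.factorial_pos _
  have hH0 : H ≠ 0 := by
    rintro h0
    rw [h0, mul_zero] at hCk
    exact (pow_pos hCkpos _).ne' hCk
  have hval : (α * (n + 1 : ℕ) - d) / sArea d *
      ∫ x : Euc d, φ (fun _ => x) * ‖x‖ ^ (-(α * ((n + 1 : ℕ) : ℝ))) =
      1 / ((Nat.factorial (n + 1) : ℝ) * Ck ^ (n + 1)) * ((α * (n + 1 : ℕ) - d) *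
        ((∫ x : Euc d, φ (fun _ => x) * ‖x‖ ^ (-(α * ((n + 1 : ℕ) : ℝ)))) * H)) := by
    rw [hCk]
    field_simp
  rw [hval]
  refine hlim.congr' ?_
  filter_upwards [hmpos, hR.eventually_gt_atTop 0, hR.eventually hfpos] with j hmj hRj hfj
  simp only [Function.comp_apply] at hRj hfj ⊢
  set R := Rk (Ck * j / m j) with hRdef
  have hmj' : (0 : ℝ) < m j := by exact_mod_cast hmj
  have hmeas : Measurable fun y : Fin (n + 1) → Euc d =>
      φ (fun i => R⁻¹ • y i) * h y * ∏ i, f ‖y i‖ :=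
    ((hφc.measurable.comp (by fun_prop)).mul hhm).mul
      (Finset.measurable_prod _ fun i _ => hfm.comp (measurable_pi_apply i).norm)
  rw [integral_eq_integral_smul_add_padFirst hRj hmeas]
  have hint : ∫ p : Euc d × (Fin n → Euc d),
      φ (fun i => R⁻¹ • (R • p.1 + padFirst (n + 1) p.2 i)) *
        h (fun i => R • p.1 + padFirst (n + 1) p.2 i) *
        ∏ i, f ‖R • p.1 + padFirst (n + 1) p.2 i‖ =
      f R ^ (n + 1) * ∫ p : Euc d × (Fin n → Euc d),
        φ (fun i => p.1 + R⁻¹ • padFirst (n + 1) p.2 i) * h (padFirst (n + 1) p.2) *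
          ∏ i, f ‖R • p.1 + padFirst (n + 1) p.2 i‖ / f R := by
    rw [← integral_const_mul]
    congr 1
    funext p
    simp only [smul_add, inv_smul_smul₀ hRj.ne', hhtrans, Finset.prod_div_distrib,
      Finset.prod_const, Finset.card_univ, Fintype.card_fin]
    field_simp
  rw [hint, div_pow, mul_pow]
  field_simp
end
end
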